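/- For τ₁, τ₂ ∈ L, let ξ₁ ≥ ξ₂ > 0 be the eigenvalues of τ₂ with respect to τ₁, i.e. ξ_{1,2} = (Ψ(τ₁,τ₂) ± √(Ψ(τ₁,τ₂)² − Ψ(τ₁,τ₁)Ψ(τ₂,τ₂)))/Ψ(τ₁,τ₁). Then the likelihood ratio statistic for testing equality of the two parameters satisfies (f_{σ̂}(τ₁) · f_{σ̂}(τ₂)) / (f_{τ₁}(τ₁) · f_{τ₂}(τ₂)) = (16 ξ₁ ξ₂ / ((1+ξ₁)² (1+ξ₂)²))^η, where σ̂ = (τ₁+τ₂)/2 and f_σ is the Lorentz Wishart density with shape parameter η. -/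

import Mathlib

open scoped RealInnerProductSpace Classical

/-- The symmetric bilinear form `Ψ((λ,w),(μ,u)) = λμ − ⟪w,u⟫` on `ℝ × W`. -/
noncomputable def Psi {m : ℕ} (x y : ℝ × EuclideanSpace ℝ (Fin m)) : ℝ :=
  x.1 * y.1 - ⟪x.2, y.2⟫

/-- The Lorentz cone `L = {(λ,w) : λ > 0, λ² > ‖w‖²}`. -/
def LorentzCone (m : ℕ) : Set (ℝ × EuclideanSpace ℝ (Fin m)) :=
  {x | 0 < x.1 ∧ ‖x.2‖ ^ 2 < x.1 ^ 2}

/-- The normalizing constant `k(m,η) = 2 π^{(m−1)/2} Γ(η) Γ(η − (m−1)/2) η^{−2η}`. -/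
noncomputable def kConst (m : ℕ) (η : ℝ) : ℝ :=
  2 * Real.pi ^ (((m : ℝ) - 1) / 2) * Real.Gamma η * Real.Gamma (η - ((m : ℝ) - 1) / 2) *
    η ^ (-(2 * η))

/-- The Lorentz Wishart density `f_σ` with shape parameter `η` and scale parameter `σ ∈ L`,
with respect to Lebesgue measure on `ℝ × W`. -/

noncomputable def wishartDensity (m : ℕ) (η : ℝ) (σ : ℝ × EuclideanSpace ℝ (Fin m))
    (x : ℝ × EuclideanSpace ℝ (Fin m)) : ℝ :=
  if x ∈ LorentzCone m then
    (kConst m η)⁻¹ * (σ.1 ^ 2 - ‖σ.2‖ ^ 2) ^ (-η) *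
      (x.1 ^ 2 - ‖x.2‖ ^ 2) ^ (η - ((m : ℝ) + 1) / 2) *
      Real.exp (-2 * η * (σ.1 * x.1 - ⟪σ.2, x.2⟫) / (σ.1 ^ 2 - ‖σ.2‖ ^ 2))
  else 0

/-- The eigenvalues `(ξ₁, ξ₂)` of `σ₂` with respect to `σ₁`. -/
noncomputable def piStat {m : ℕ} (σ₁ σ₂ : ℝ × EuclideanSpace ℝ (Fin m)) : ℝ × ℝ :=
  ((Psi σ₁ σ₂ + Real.sqrt ((Psi σ₁ σ₂) ^ 2 - Psi σ₁ σ₁ * Psi σ₂ σ₂)) / Psi σ₁ σ₁,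
   (Psi σ₁ σ₂ - Real.sqrt ((Psi σ₁ σ₂) ^ 2 - Psi σ₁ σ₁ * Psi σ₂ σ₂)) / Psi σ₁ σ₁)

theorem kConst_pos {m : ℕ} {η : ℝ} (hm : 1 ≤ m) (hη : ((m : ℝ) - 1) / 2 < η) :
    0 < kConst m η := by
  have hm' : (1 : ℝ) ≤ m := by exact_mod_cast hm
  have hη0 : 0 < η := by linarith
  have h1 := Real.Gamma_pos_of_pos hη0
  have h2 := Real.Gamma_pos_of_pos (sub_pos.mpr hη)
  have h3 := Real.rpow_pos_of_pos hη0 (-(2 * η))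
  have h4 := Real.rpow_pos_of_pos Real.pi_pos (((m : ℝ) - 1) / 2)
  unfold kConst
  positivity

theorem Psi_self {m : ℕ} (x : ℝ × EuclideanSpace ℝ (Fin m)) :
    Psi x x = x.1 ^ 2 - ‖x.2‖ ^ 2 := by
  rw [Psi, real_inner_self_eq_norm_sq, sq x.1]

theorem Psi_self_pos {m : ℕ} {x : ℝ × EuclideanSpace ℝ (Fin m)} (hx : x ∈ LorentzCone m) :
    0 < Psi x x := by
  rw [Psi_self]
  exact sub_pos.mpr hx.2

theorem norm_lt_of_mem_LorentzCone {m : ℕ} {x : ℝ × EuclideanSpace ℝ (Fin m)}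
    (hx : x ∈ LorentzCone m) : ‖x.2‖ < x.1 :=
  lt_of_pow_lt_pow_left₀ 2 hx.1.le hx.2

theorem norm_mul_norm_lt_of_mem_LorentzCone {m : ℕ} {x y : ℝ × EuclideanSpace ℝ (Fin m)}
    (hx : x ∈ LorentzCone m) (hy : y ∈ LorentzCone m) : ‖x.2‖ * ‖y.2‖ < x.1 * y.1 :=
  mul_lt_mul'' (norm_lt_of_mem_LorentzCone hx) (norm_lt_of_mem_LorentzCone hy)
    (norm_nonneg _) (norm_nonneg _)

theorem Psi_pos {m : ℕ} {x y : ℝ × EuclideanSpace ℝ (Fin m)}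
    (hx : x ∈ LorentzCone m) (hy : y ∈ LorentzCone m) : 0 < Psi x y :=
  sub_pos.mpr ((real_inner_le_norm x.2 y.2).trans_lt (norm_mul_norm_lt_of_mem_LorentzCone hx hy))

/-- The reverse Cauchy–Schwarz inequality on the Lorentz cone. -/
theorem Psi_self_mul_Psi_self_le {m : ℕ} {x y : ℝ × EuclideanSpace ℝ (Fin m)}
    (hx : x ∈ LorentzCone m) (hy : y ∈ LorentzCone m) :
    Psi x x * Psi y y ≤ Psi x y ^ 2 := by
  have h1 : x.1 * y.1 - ‖x.2‖ * ‖y.2‖ ≤ Psi x y :=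
    sub_le_sub_left (real_inner_le_norm x.2 y.2) _
  have h2 := norm_mul_norm_lt_of_mem_LorentzCone hx hy
  calc Psi x x * Psi y y ≤ (x.1 * y.1 - ‖x.2‖ * ‖y.2‖) ^ 2 := by
        rw [Psi_self, Psi_self]
        nlinarith [sq_nonneg (x.1 * ‖y.2‖ - y.1 * ‖x.2‖)]
    _ ≤ Psi x y ^ 2 := pow_le_pow_left₀ (sub_nonneg.mpr h2.le) h1 2

theorem Psi_half_add_left {m : ℕ} (x y z : ℝ × EuclideanSpace ℝ (Fin m)) :
    Psi ((2 : ℝ)⁻¹ • (x + y)) z = (Psi x z + Psi y z) / 2 := by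
  simp only [Psi, Prod.smul_fst, Prod.smul_snd, Prod.fst_add, Prod.snd_add, smul_eq_mul,
    real_inner_smul_left, inner_add_left]
  ring

theorem Psi_comm {m : ℕ} (x y : ℝ × EuclideanSpace ℝ (Fin m)) : Psi x y = Psi y x := by
  rw [Psi, Psi, real_inner_comm, mul_comm]

theorem Psi_half_add_self {m : ℕ} (x y : ℝ × EuclideanSpace ℝ (Fin m)) :
    Psi ((2 : ℝ)⁻¹ • (x + y)) ((2 : ℝ)⁻¹ • (x + y)) =
      (Psi x x + 2 * Psi x y + Psi y y) / 4 := by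
  rw [Psi_half_add_left, Psi_comm x, Psi_comm y, Psi_half_add_left, Psi_half_add_left,
    Psi_comm y x]
  ring

theorem wishartDensity_of_mem {m : ℕ} (η : ℝ) (σ : ℝ × EuclideanSpace ℝ (Fin m))
    {x : ℝ × EuclideanSpace ℝ (Fin m)} (hx : x ∈ LorentzCone m) :
    wishartDensity m η σ x =
      (kConst m η)⁻¹ * Psi σ σ ^ (-η) * Psi x x ^ (η - ((m : ℝ) + 1) / 2) *
        Real.exp (-2 * η * Psi σ x / Psi σ σ) := by
  rw [wishartDensity, if_pos hx, Psi_self, Psi_self, Psi]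

theorem piStat_fst_mul_snd {m : ℕ} {x y : ℝ × EuclideanSpace ℝ (Fin m)}
    (hx : x ∈ LorentzCone m) (hy : y ∈ LorentzCone m) :
    (piStat x y).1 * (piStat x y).2 = Psi y y / Psi x x := by
  have hA := (Psi_self_pos hx).ne'
  have hs := Real.sq_sqrt (sub_nonneg.mpr (Psi_self_mul_Psi_self_le hx hy))
  simp only [piStat]
  rw [div_mul_div_comm, div_eq_div_iff (mul_ne_zero hA hA) hA]
  linear_combination (-Psi x x) * hs

theorem piStat_fst_add_snd {m : ℕ} (x y : ℝ × EuclideanSpace ℝ (Fin m)) :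
    (piStat x y).1 + (piStat x y).2 = 2 * Psi x y / Psi x x := by
  simp only [piStat]
  ring

/-- The product of two Wishart densities at the averaged scale, relative to the product at the
individual scales. -/
theorem wishartDensity_ratio {m : ℕ} {η : ℝ} (hm : 1 ≤ m) (hη : ((m : ℝ) - 1) / 2 < η)
    {x y : ℝ × EuclideanSpace ℝ (Fin m)} (hx : x ∈ LorentzCone m) (hy : y ∈ LorentzCone m) :
    (wishartDensity m η ((2 : ℝ)⁻¹ • (x + y)) x * wishartDensity m η ((2 : ℝ)⁻¹ • (x + y)) y) /
      (wishartDensity m η x x * wishartDensity m η y y) =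
      (Psi x x * Psi y y /
        Psi ((2 : ℝ)⁻¹ • (x + y)) ((2 : ℝ)⁻¹ • (x + y)) ^ 2) ^ η := by
  have hk := (kConst_pos hm hη).ne'
  have hA := Psi_self_pos hx
  have hB := Psi_self_pos hy
  have hP := Psi_pos hx hy
  have hS : 0 < Psi ((2 : ℝ)⁻¹ • (x + y)) ((2 : ℝ)⁻¹ • (x + y)) := by
    rw [Psi_half_add_self]
    positivity
  have hsum : Psi ((2 : ℝ)⁻¹ • (x + y)) x + Psi ((2 : ℝ)⁻¹ • (x + y)) y =
      2 * Psi ((2 : ℝ)⁻¹ • (x + y)) ((2 : ℝ)⁻¹ • (x + y)) := by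
    rw [Psi_half_add_self, Psi_half_add_left, Psi_half_add_left, Psi_comm y x]
    ring
  simp only [wishartDensity_of_mem _ _ hx, wishartDensity_of_mem _ _ hy]
  generalize Psi ((2 : ℝ)⁻¹ • (x + y)) ((2 : ℝ)⁻¹ • (x + y)) = S at hS hsum ⊢
  generalize Psi ((2 : ℝ)⁻¹ • (x + y)) x = p at hsum ⊢
  generalize Psi ((2 : ℝ)⁻¹ • (x + y)) y = q at hsum ⊢
  generalize Psi x x = A at hA ⊢
  generalize Psi y y = B at hB ⊢
  have hexp : Real.exp (-2 * η * p / S) * Real.exp (-2 * η * q / S) =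
      Real.exp (-2 * η * A / A) * Real.exp (-2 * η * B / B) := by
    rw [← Real.exp_add, ← Real.exp_add, ← add_div, ← mul_add, hsum]
    congr 1
    field_simp
    ring
  rw [Real.div_rpow (mul_pos hA hB).le (by positivity), Real.mul_rpow hA.le hB.le, sq,
    Real.mul_rpow hS.le hS.le, Real.rpow_neg hS.le, Real.rpow_neg hA.le, Real.rpow_neg hB.le]
  have hSη := (Real.rpow_pos_of_pos hS η).ne'
  have hAη := (Real.rpow_pos_of_pos hA η).ne'
  have hBη := (Real.rpow_pos_of_pos hB η).ne'
  have hAν := (Real.rpow_pos_of_pos hA (η - ((m : ℝ) + 1) / 2)).ne'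
  have hBν := (Real.rpow_pos_of_pos hB (η - ((m : ℝ) + 1) / 2)).ne'
  have he₁ := Real.exp_ne_zero (-2 * η * A / A)
  have he₂ := Real.exp_ne_zero (-2 * η * B / B)
  generalize A ^ (η - ((m : ℝ) + 1) / 2) = a at *
  generalize B ^ (η - ((m : ℝ) + 1) / 2) = b at *
  generalize Real.exp (-2 * η * A / A) = e₁ at *
  generalize Real.exp (-2 * η * B / B) = e₂ at *
  generalize Real.exp (-2 * η * p / S) = e₃ at *
  generalize Real.exp (-2 * η * q / S) = e₄ at *
  generalize S ^ η = s at *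
  generalize A ^ η = u at *
  generalize B ^ η = v at *
  rw [div_eq_div_iff (by positivity) (by positivity)]
  field_simp
  linear_combination hexp

theorem likelihood_ratio_T2 (m : ℕ) (hm : 1 ≤ m) (η : ℝ) (hη : ((m : ℝ) - 1) / 2 < η)
    (τ₁ τ₂ : ℝ × EuclideanSpace ℝ (Fin m))
    (h₁ : τ₁ ∈ LorentzCone m) (h₂ : τ₂ ∈ LorentzCone m) :
    (wishartDensity m η ((2:ℝ)⁻¹ • (τ₁ + τ₂)) τ₁ *
        wishartDensity m η ((2:ℝ)⁻¹ • (τ₁ + τ₂)) τ₂) /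
      (wishartDensity m η τ₁ τ₁ * wishartDensity m η τ₂ τ₂) =
      (16 * (piStat τ₁ τ₂).1 * (piStat τ₁ τ₂).2 /
        ((1 + (piStat τ₁ τ₂).1) ^ 2 * (1 + (piStat τ₁ τ₂).2) ^ 2)) ^ η := by
  rw [wishartDensity_ratio hm hη h₁ h₂]
  congr 1
  have hA := Psi_self_pos h₁
  have hB := Psi_self_pos h₂
  have hP := Psi_pos h₁ h₂
  have hden : (1 + (piStat τ₁ τ₂).1) * (1 + (piStat τ₁ τ₂).2) =
      (Psi τ₁ τ₁ + 2 * Psi τ₁ τ₂ + Psi τ₂ τ₂) / Psi τ₁ τ₁ := by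
    have hone := div_self hA.ne'
    linear_combination piStat_fst_mul_snd h₁ h₂ + piStat_fst_add_snd τ₁ τ₂ - hone
  rw [mul_assoc, piStat_fst_mul_snd h₁ h₂, ← mul_pow, hden, Psi_half_add_self]
  have hT : Psi τ₁ τ₁ + 2 * Psi τ₁ τ₂ + Psi τ₂ τ₂ ≠ 0 := by positivity
  field_simp
  norm_num
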